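/- Let R ≥ 1, T > 0, let f : (0,∞) → ℝ be C¹, and let (u,m) be a classical R-periodic solution of the 1D MFG system with coupling f on ℝ × [0,T]. Let h : (0,∞) → ℝ be C². Then the map t ↦ ∫_0^R h(m(x,t)) dx is twice differentiable on (0,T) and for every t ∈ (0,T) its second derivative equals ∫_0^R m·h''(m)·( m·u_{xx}² + f'(m)·m_x² ) dx, where the integrand is evaluated at (x,t). -/

import Mathlib

open Set

/-- Partial derivative in the first (space) variable. -/
noncomputable def pdx (u : ℝ → ℝ → ℝ) (x t : ℝ) : ℝ := deriv (fun y => u y t) x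

/-- Partial derivative in the second (time) variable. -/
noncomputable def pdt (u : ℝ → ℝ → ℝ) (x t : ℝ) : ℝ := deriv (fun s => u x s) t

open MeasureTheory Topology Filter

/-- The open space-time strip `ℝ × (0,T)`. -/
def openStrip (T : ℝ) : Set (ℝ × ℝ) := {p | p.2 ∈ Ioo 0 T}

lemma isOpen_openStrip (T : ℝ) : IsOpen (openStrip T) := isOpen_Ioo.preimage continuous_snd

section Partials

variable {T : ℝ} {U : ℝ → ℝ → ℝ}

lemma hasDerivAt_pdx_fderiv {x t : ℝ}
    (hU : DifferentiableAt ℝ (fun p : ℝ × ℝ => U p.1 p.2) (x, t)) :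
    HasDerivAt (fun y => U y t) (fderiv ℝ (fun p : ℝ × ℝ => U p.1 p.2) (x, t) (1, 0)) x := by
  have h1 : HasDerivAt (fun y : ℝ => (y, t)) ((1 : ℝ), (0 : ℝ)) x :=
    (hasDerivAt_id x).prodMk (hasDerivAt_const x t)
  exact HasFDerivAt.comp_hasDerivAt (f := fun y : ℝ => (y, t)) x hU.hasFDerivAt h1

lemma hasDerivAt_pdt_fderiv {x t : ℝ}
    (hU : DifferentiableAt ℝ (fun p : ℝ × ℝ => U p.1 p.2) (x, t)) :
    HasDerivAt (fun s => U x s) (fderiv ℝ (fun p : ℝ × ℝ => U p.1 p.2) (x, t) (0, 1)) t := by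
  have h1 : HasDerivAt (fun s : ℝ => (x, s)) ((0 : ℝ), (1 : ℝ)) t :=
    (hasDerivAt_const t x).prodMk (hasDerivAt_id t)
  exact HasFDerivAt.comp_hasDerivAt (f := fun s : ℝ => (x, s)) t hU.hasFDerivAt h1

lemma ContDiffOn.differentiableAt_openStrip
    (hU : ContDiffOn ℝ (⊤ : ℕ∞) (fun p : ℝ × ℝ => U p.1 p.2) (openStrip T))
    (x : ℝ) {t : ℝ} (ht : t ∈ Ioo 0 T) :
    DifferentiableAt ℝ (fun p : ℝ × ℝ => U p.1 p.2) (x, t) :=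
  (hU.contDiffAt ((isOpen_openStrip T).mem_nhds (show (x, t) ∈ openStrip T from ht))).differentiableAt
    (by simp)

lemma pdx_eq_fderiv {x t : ℝ}
    (hU : DifferentiableAt ℝ (fun p : ℝ × ℝ => U p.1 p.2) (x, t)) :
    pdx U x t = fderiv ℝ (fun p : ℝ × ℝ => U p.1 p.2) (x, t) (1, 0) :=
  (hasDerivAt_pdx_fderiv hU).deriv

lemma pdt_eq_fderiv {x t : ℝ}
    (hU : DifferentiableAt ℝ (fun p : ℝ × ℝ => U p.1 p.2) (x, t)) :
    pdt U x t = fderiv ℝ (fun p : ℝ × ℝ => U p.1 p.2) (x, t) (0, 1) :=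
  (hasDerivAt_pdt_fderiv hU).deriv

lemma ContDiffOn.hasDerivAt_pdx
    (hU : ContDiffOn ℝ (⊤ : ℕ∞) (fun p : ℝ × ℝ => U p.1 p.2) (openStrip T))
    (x : ℝ) {t : ℝ} (ht : t ∈ Ioo 0 T) : HasDerivAt (fun y => U y t) (pdx U x t) x :=
  (hasDerivAt_pdx_fderiv (hU.differentiableAt_openStrip x ht)).differentiableAt.hasDerivAt

lemma ContDiffOn.hasDerivAt_pdt
    (hU : ContDiffOn ℝ (⊤ : ℕ∞) (fun p : ℝ × ℝ => U p.1 p.2) (openStrip T))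
    (x : ℝ) {t : ℝ} (ht : t ∈ Ioo 0 T) : HasDerivAt (fun s => U x s) (pdt U x t) t :=
  (hasDerivAt_pdt_fderiv (hU.differentiableAt_openStrip x ht)).differentiableAt.hasDerivAt

lemma ContDiffOn.fderiv_apply_openStrip {F : ℝ × ℝ → ℝ}
    (hF : ContDiffOn ℝ (⊤ : ℕ∞) F (openStrip T)) (v : ℝ × ℝ) :
    ContDiffOn ℝ (⊤ : ℕ∞) (fun p => fderiv ℝ F p v) (openStrip T) :=
  (hF.fderiv_of_isOpen (isOpen_openStrip T) (by simp)).clm_apply contDiffOn_const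

lemma ContDiffOn.pdx
    (hU : ContDiffOn ℝ (⊤ : ℕ∞) (fun p : ℝ × ℝ => U p.1 p.2) (openStrip T)) :
    ContDiffOn ℝ (⊤ : ℕ∞) (fun p : ℝ × ℝ => pdx U p.1 p.2) (openStrip T) :=
  (hU.fderiv_apply_openStrip (1, 0)).congr fun p hp =>
    pdx_eq_fderiv (hU.differentiableAt_openStrip p.1 hp)

lemma ContDiffOn.pdt
    (hU : ContDiffOn ℝ (⊤ : ℕ∞) (fun p : ℝ × ℝ => U p.1 p.2) (openStrip T)) :
    ContDiffOn ℝ (⊤ : ℕ∞) (fun p : ℝ × ℝ => pdt U p.1 p.2) (openStrip T) :=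
  (hU.fderiv_apply_openStrip (0, 1)).congr fun p hp =>
    pdt_eq_fderiv (hU.differentiableAt_openStrip p.1 hp)

/-- Mixed partial derivatives commute. -/
lemma ContDiffOn.pdt_pdx_comm
    (hU : ContDiffOn ℝ (⊤ : ℕ∞) (fun p : ℝ × ℝ => U p.1 p.2) (openStrip T))
    (x : ℝ) {t : ℝ} (ht : t ∈ Ioo 0 T) :
    _root_.pdt (_root_.pdx U) x t = _root_.pdx (_root_.pdt U) x t := by
  have hmem : openStrip T ∈ 𝓝 (x, t) := (isOpen_openStrip T).mem_nhds ht
  have hcd := hU.contDiffAt hmem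
  have hsymm : IsSymmSndFDerivAt ℝ (fun p : ℝ × ℝ => U p.1 p.2) (x, t) :=
    hcd.isSymmSndFDerivAt (by
      rw [minSmoothness_of_isRCLikeNormedField]
      norm_cast)
  have hdd : DifferentiableAt ℝ (fderiv ℝ (fun p : ℝ × ℝ => U p.1 p.2)) (x, t) :=
    (hcd.fderiv_right (m := 1) (by norm_cast)).differentiableAt (by simp)
  have key (v : ℝ × ℝ) {G : ℝ × ℝ → ℝ}
      (hG : ∀ p ∈ openStrip T, G p = fderiv ℝ (fun p : ℝ × ℝ => U p.1 p.2) p v) (w : ℝ × ℝ) :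
      fderiv ℝ G (x, t) w
        = fderiv ℝ (fderiv ℝ (fun p : ℝ × ℝ => U p.1 p.2)) (x, t) w v := by
    have heq : G =ᶠ[𝓝 (x, t)] fun p => fderiv ℝ (fun p : ℝ × ℝ => U p.1 p.2) p v :=
      eventually_of_mem hmem hG
    rw [heq.fderiv_eq, fderiv_clm_apply hdd (differentiableAt_const v)]
    simp
  rw [pdt_eq_fderiv (hU.pdx.differentiableAt_openStrip x ht),
    pdx_eq_fderiv (hU.pdt.differentiableAt_openStrip x ht),
    key (1, 0) (fun p hp => pdx_eq_fderiv (hU.differentiableAt_openStrip p.1 hp)) (0, 1),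
    key (0, 1) (fun p hp => pdt_eq_fderiv (hU.differentiableAt_openStrip p.1 hp)) (1, 0)]
  exact hsymm (0, 1) (1, 0)

lemma pdx_periodic {R t : ℝ} (hper : ∀ x, U (x + R) t = U x t) (x : ℝ) :
    pdx U (x + R) t = pdx U x t := by
  rw [pdx, pdx, ← deriv_comp_add_const]
  simp only [hper]

lemma pdt_periodic {R t : ℝ} (ht : t ∈ Ioo 0 T)
    (hper : ∀ x, ∀ s ∈ Ioo 0 T, U (x + R) s = U x s) (x : ℝ) :
    pdt U (x + R) t = pdt U x t :=
  Filter.EventuallyEq.deriv_eq (eventually_of_mem (isOpen_Ioo.mem_nhds ht) fun s hs => hper x s hs)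

end Partials

lemma ContinuousOn.slice_openStrip {T : ℝ} {G : ℝ → ℝ → ℝ}
    (hG : ContinuousOn (fun p : ℝ × ℝ => G p.1 p.2) (openStrip T)) {t : ℝ} (ht : t ∈ Ioo 0 T) :
    Continuous fun x => G x t :=
  hG.comp_continuous (f := fun x : ℝ => (x, t)) (by fun_prop) fun _ => ht

/-- Differentiation under the integral sign over a compact interval. -/
lemma hasDerivAt_integral_openStrip {T R : ℝ} {G G' : ℝ → ℝ → ℝ}
    (hG : ContinuousOn (fun p : ℝ × ℝ => G p.1 p.2) (openStrip T))
    (hG' : ContinuousOn (fun p : ℝ × ℝ => G' p.1 p.2) (openStrip T))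
    (hd : ∀ x, ∀ t ∈ Ioo 0 T, HasDerivAt (fun s => G x s) (G' x t) t)
    {t : ℝ} (ht : t ∈ Ioo 0 T) :
    HasDerivAt (fun s => ∫ x in (0:ℝ)..R, G x s) (∫ x in (0:ℝ)..R, G' x t) t := by
  obtain ⟨ε, hε, hsub⟩ := Metric.nhds_basis_closedBall.mem_iff.1 (isOpen_Ioo.mem_nhds ht)
  have hK : IsCompact (uIcc 0 R ×ˢ Metric.closedBall t ε) :=
    isCompact_uIcc.prod (isCompact_closedBall t ε)
  obtain ⟨C, hC⟩ := hK.exists_bound_of_continuousOn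
    (hG'.mono fun p hp => hsub hp.2)
  refine (intervalIntegral.hasDerivAt_integral_of_dominated_loc_of_deriv_le
    (bound := fun _ => C) (F := fun s x => G x s) (F' := fun s x => G' x s)
    (Metric.closedBall_mem_nhds t hε) ?_ ?_ ?_ ?_ ?_ ?_).2
  · exact eventually_of_mem (isOpen_Ioo.mem_nhds ht) fun s hs =>
      (hG.slice_openStrip hs).aestronglyMeasurable
  · exact (hG.slice_openStrip ht).intervalIntegrable _ _
  · exact (hG'.slice_openStrip ht).aestronglyMeasurable
  · exact Eventually.of_forall fun x hx s hs => hC (x, s) ⟨uIoc_subset_uIcc hx, hs⟩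
  · exact intervalIntegrable_const
  · exact Eventually.of_forall fun x _ s hs => hd x s (hsub hs)

/-- Integrals of functions differing by the derivative of a function with equal endpoint values
agree. -/
lemma integral_eq_of_sub_eq_deriv {R : ℝ} {A B P : ℝ → ℝ} (hA : Continuous A) (hB : Continuous B)
    (hP : ∀ x, HasDerivAt P (A x - B x) x) (hper : P R = P 0) :
    ∫ x in (0:ℝ)..R, A x = ∫ x in (0:ℝ)..R, B x := by
  have h0 := intervalIntegral.integral_eq_sub_of_hasDerivAt (a := 0) (b := R)
    (fun x _ => hP x) ((hA.sub hB).intervalIntegrable _ _)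
  rw [intervalIntegral.integral_sub (hA.intervalIntegrable _ _) (hB.intervalIntegrable _ _),
    hper, sub_self] at h0
  exact sub_eq_zero.1 h0

/-- Displacement convexity: for a classical `R`-periodic solution `(u, m)` of the 1D MFG
system with C¹ coupling `f` on `ℝ × [0,T]` and a C² function `h` on `(0,∞)`, the map
`t ↦ ∫₀ᴿ h(m(x,t)) dx` is twice differentiable on `(0,T)` and its second derivative is
`∫₀ᴿ m h''(m) (m u_xx² + f'(m) m_x²) dx`. -/
theorem stmt3
    (R T : ℝ) (hR : 1 ≤ R) (hT : 0 < T)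
    (f : ℝ → ℝ) (hf : ContDiffOn ℝ 1 f (Ioi 0))
    (u m : ℝ → ℝ → ℝ)
    (hu : ContDiffOn ℝ (⊤ : ℕ∞) (fun p : ℝ × ℝ => u p.1 p.2) {p : ℝ × ℝ | p.2 ∈ Icc 0 T})
    (hm : ContDiffOn ℝ (⊤ : ℕ∞) (fun p : ℝ × ℝ => m p.1 p.2) {p : ℝ × ℝ | p.2 ∈ Icc 0 T})
    (huper : ∀ x t : ℝ, t ∈ Icc 0 T → u (x + R) t = u x t)
    (hmper : ∀ x t : ℝ, t ∈ Icc 0 T → m (x + R) t = m x t)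
    (hmpos : ∀ x t : ℝ, t ∈ Icc 0 T → 0 < m x t)
    (hHJ : ∀ x t : ℝ, t ∈ Icc 0 T →
      -pdt u x t + (1/2) * (pdx u x t)^2 = f (m x t))
    (hCE : ∀ x t : ℝ, t ∈ Icc 0 T →
      pdt m x t - pdx (fun y s => m y s * pdx u y s) x t = 0)
    (h : ℝ → ℝ) (hh : ContDiffOn ℝ 2 h (Ioi 0)) :
    (∀ t ∈ Ioo 0 T,
      DifferentiableAt ℝ (fun s => ∫ x in (0:ℝ)..R, h (m x s)) t) ∧
    (∀ t ∈ Ioo 0 T,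
      DifferentiableAt ℝ (deriv (fun s => ∫ x in (0:ℝ)..R, h (m x s))) t ∧
      deriv (deriv (fun s => ∫ x in (0:ℝ)..R, h (m x s))) t
        = ∫ x in (0:ℝ)..R,
            m x t * deriv (deriv h) (m x t)
              * (m x t * (pdx (pdx u) x t)^2 + deriv f (m x t) * (pdx m x t)^2)) := by
  have hsubs : openStrip T ⊆ {p : ℝ × ℝ | p.2 ∈ Icc 0 T} := fun p hp => Ioo_subset_Icc_self hp
  have hu' := hu.mono hsubs
  have hm' := hm.mono hsubs
  have hpos : ∀ x, ∀ t ∈ Ioo 0 T, m x t ∈ Ioi (0 : ℝ) :=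
    fun x t ht => hmpos x t (Ioo_subset_Icc_self ht)
  have hdh : ContDiffOn ℝ 1 (deriv h) (Ioi 0) := hh.deriv_of_isOpen isOpen_Ioi (by norm_num)
  have hddh : ContinuousOn (deriv (deriv h)) (Ioi 0) :=
    hdh.continuousOn_deriv_of_isOpen isOpen_Ioi le_rfl
  have hdf : ContinuousOn (deriv f) (Ioi 0) := hf.continuousOn_deriv_of_isOpen isOpen_Ioi le_rfl
  have dh : ∀ y ∈ Ioi (0 : ℝ), HasDerivAt h (deriv h y) y := fun y hy =>
    ((hh.contDiffAt (Ioi_mem_nhds hy)).differentiableAt (by simp)).hasDerivAt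
  have ddh : ∀ y ∈ Ioi (0 : ℝ), HasDerivAt (deriv h) (deriv (deriv h) y) y := fun y hy =>
    ((hdh.contDiffAt (Ioi_mem_nhds hy)).differentiableAt (by simp)).hasDerivAt
  have df : ∀ y ∈ Ioi (0 : ℝ), HasDerivAt f (deriv f y) y := fun y hy =>
    ((hf.contDiffAt (Ioi_mem_nhds hy)).differentiableAt (by simp)).hasDerivAt
  have dg : ∀ y ∈ Ioi (0 : ℝ),
      HasDerivAt (fun z => z * deriv h z - h z) (y * deriv (deriv h) y) y := fun y hy => by
    refine (((hasDerivAt_id y).mul (ddh y hy)).sub (dh y hy)).congr_deriv ?_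
    simp only [id_eq]
    ring
  have comp_m : ∀ {k : ℝ → ℝ}, ContinuousOn k (Ioi 0) →
      ContinuousOn (fun p : ℝ × ℝ => k (m p.1 p.2)) (openStrip T) := fun hk =>
    hk.comp hm'.continuousOn fun p hp => hpos p.1 p.2 hp
  have cm := hm'.continuousOn
  have cmx := hm'.pdx.continuousOn
  have cmt := hm'.pdt.continuousOn
  have cux := hu'.pdx.continuousOn
  have cuxx := hu'.pdx.pdx.continuousOn
  have cuxxt := hu'.pdx.pdx.pdt.continuousOn
  have ch := comp_m hh.continuousOn
  have cdh := comp_m hdh.continuousOn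
  have cddh := comp_m hddh
  have cdf := comp_m hdf
  have continuity_eq : ∀ x, ∀ t ∈ Ioo 0 T,
      pdt m x t = pdx m x t * pdx u x t + m x t * pdx (pdx u) x t := fun x t ht => by
    have hprod := (hm'.hasDerivAt_pdx x ht).mul (hu'.pdx.hasDerivAt_pdx x ht)
    exact (sub_eq_zero.1 (hCE x t (Ioo_subset_Icc_self ht))).trans hprod.deriv
  have hamilton_jacobi_x : ∀ x, ∀ t ∈ Ioo 0 T,
      pdt (pdx u) x t = pdx u x t * pdx (pdx u) x t - deriv f (m x t) * pdx m x t :=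
    fun x t ht => by
    rw [hu'.pdt_pdx_comm x ht]
    have heq : (fun y => pdt u y t) = fun y => (1/2) * (pdx u y t)^2 - f (m y t) := by
      funext y
      linarith [hHJ y t (Ioo_subset_Icc_self ht)]
    have h1 := (((hu'.pdx.hasDerivAt_pdx x ht).pow 2).const_mul (1/2)).sub
      ((df _ (hpos x t ht)).comp x (hm'.hasDerivAt_pdx x ht))
    have h2 : pdx (pdt u) x t = _ := (congrArg (fun g => deriv g x) heq).trans h1.deriv
    rw [h2]
    ring
  have hper : ∀ t ∈ Ioo 0 T, m R t = m 0 t := fun t ht => by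
    simpa using hmper 0 t (Ioo_subset_Icc_self ht)
  have huper' : ∀ x, ∀ t ∈ Ioo 0 T, pdx u (x + R) t = pdx u x t := fun x t ht =>
    pdx_periodic (fun y => huper y t (Ioo_subset_Icc_self ht)) x
  have first : ∀ t ∈ Ioo 0 T, HasDerivAt (fun s => ∫ x in (0:ℝ)..R, h (m x s))
      (∫ x in (0:ℝ)..R, (m x t * deriv h (m x t) - h (m x t)) * pdx (pdx u) x t) t := by
    intro t ht
    have cG' : ContinuousOn (fun p : ℝ × ℝ => deriv h (m p.1 p.2) * pdt m p.1 p.2)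
      (openStrip T) := cdh.mul cmt
    have cB : ContinuousOn (fun p : ℝ × ℝ =>
      (m p.1 p.2 * deriv h (m p.1 p.2) - h (m p.1 p.2)) * pdx (pdx u) p.1 p.2)
      (openStrip T) := ((cm.mul cdh).sub ch).mul cuxx
    refine (hasDerivAt_integral_openStrip (R := R) (G := fun x s => h (m x s))
      (G' := fun x s => deriv h (m x s) * pdt m x s) ch cG'
      (fun x s hs => (dh _ (hpos x s hs)).comp s (hm'.hasDerivAt_pdt x hs)) ht).congr_deriv ?_
    refine integral_eq_of_sub_eq_deriv (P := fun x => h (m x t) * pdx u x t)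
      (cG'.slice_openStrip (G := fun x s => deriv h (m x s) * pdt m x s) ht)
      (cB.slice_openStrip (G := fun x s =>
        (m x s * deriv h (m x s) - h (m x s)) * pdx (pdx u) x s) ht) (fun x => ?_) ?_
    · refine (((dh _ (hpos x t ht)).comp x (hm'.hasDerivAt_pdx x ht)).mul
        (hu'.pdx.hasDerivAt_pdx x ht)).congr_deriv ?_
      rw [continuity_eq x t ht]
      simp only [Function.comp_apply]
      ring
    · simpa [hper t ht] using Or.inl (huper' 0 t ht)
  have second : ∀ t ∈ Ioo 0 T, HasDerivAt (deriv (fun s => ∫ x in (0:ℝ)..R, h (m x s)))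
      (∫ x in (0:ℝ)..R, m x t * deriv (deriv h) (m x t)
        * (m x t * (pdx (pdx u) x t)^2 + deriv f (m x t) * (pdx m x t)^2)) t := by
    intro t ht
    have cG : ContinuousOn (fun p : ℝ × ℝ =>
      (m p.1 p.2 * deriv h (m p.1 p.2) - h (m p.1 p.2)) * pdx (pdx u) p.1 p.2)
      (openStrip T) := ((cm.mul cdh).sub ch).mul cuxx
    have cG' : ContinuousOn (fun p : ℝ × ℝ =>
      m p.1 p.2 * deriv (deriv h) (m p.1 p.2) * pdt m p.1 p.2 * pdx (pdx u) p.1 p.2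
        + (m p.1 p.2 * deriv h (m p.1 p.2) - h (m p.1 p.2)) * pdt (pdx (pdx u)) p.1 p.2)
      (openStrip T) :=
      (((cm.mul cddh).mul cmt).mul cuxx).add (((cm.mul cdh).sub ch).mul cuxxt)
    have cB : ContinuousOn (fun p : ℝ × ℝ => m p.1 p.2 * deriv (deriv h) (m p.1 p.2)
        * (m p.1 p.2 * (pdx (pdx u) p.1 p.2)^2 + deriv f (m p.1 p.2) * (pdx m p.1 p.2)^2))
      (openStrip T) :=
      (cm.mul cddh).mul ((cm.mul (cuxx.pow 2)).add (cdf.mul (cmx.pow 2)))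
    refine HasDerivAt.congr_of_eventuallyEq ?_
      (eventually_of_mem (isOpen_Ioo.mem_nhds ht) fun s hs => (first s hs).deriv)
    refine (hasDerivAt_integral_openStrip (R := R)
      (G := fun x s => (m x s * deriv h (m x s) - h (m x s)) * pdx (pdx u) x s)
      (G' := fun x s => m x s * deriv (deriv h) (m x s) * pdt m x s * pdx (pdx u) x s
        + (m x s * deriv h (m x s) - h (m x s)) * pdt (pdx (pdx u)) x s) cG cG'
      (fun x s hs => ((dg _ (hpos x s hs)).comp s (hm'.hasDerivAt_pdt x hs)).mul
        (hu'.pdx.pdx.hasDerivAt_pdt x hs)) ht).congr_deriv ?_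
    refine integral_eq_of_sub_eq_deriv
      (P := fun x => (m x t * deriv h (m x t) - h (m x t)) * pdt (pdx u) x t)
      (cG'.slice_openStrip (G := fun x s =>
        m x s * deriv (deriv h) (m x s) * pdt m x s * pdx (pdx u) x s
        + (m x s * deriv h (m x s) - h (m x s)) * pdt (pdx (pdx u)) x s) ht)
      (cB.slice_openStrip (G := fun x s => m x s * deriv (deriv h) (m x s)
        * (m x s * (pdx (pdx u) x s)^2 + deriv f (m x s) * (pdx m x s)^2)) ht)
      (fun x => ?_) ?_
    · refine (((dg _ (hpos x t ht)).comp x (hm'.hasDerivAt_pdx x ht)).mul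
        (hu'.pdx.pdt.hasDerivAt_pdx x ht)).congr_deriv ?_
      rw [continuity_eq x t ht, hu'.pdx.pdt_pdx_comm x ht, hamilton_jacobi_x x t ht]
      simp only [Function.comp_apply]
      ring
    · have := pdt_periodic ht huper' 0
      rw [zero_add] at this
      simp only [hper t ht, this]
  exact ⟨fun t ht => (first t ht).differentiableAt,
    fun t ht => ⟨(second t ht).differentiableAt, (second t ht).deriv⟩⟩
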